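/- arXiv:2103.07648 — 3 statements merged into one kernel-verified Lean document; each statement's English description precedes it below -/
import Mathlib

section
/- For the Lie algebra 𝔤₄,₁, the only nonzero values of the Levi-Civita connection ∇ on basis vectors are: ∇_{e₁}e₂ = ∇_{e₂}e₁ = ∇_{e₂}e₃ = ∇_{e₃}e₂ = ½e₄; ∇_{e₁}e₄ = ∇_{e₃}e₄ = ∇_{e₄}e₁ = ½e₂ and ∇_{e₄}e₃ = −½e₂; ∇_{e₂}e₄ = ½(e₁ − e₃) and ∇_{e₄}e₂ = −½(e₁ + e₃); all other ∇_{eᵢ}eⱼ vanish. -/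
noncomputable section

/-- The underlying 4-dimensional real vector space. -/
abbrev V : Type := Fin 4 → ℝ

/-- The standard basis e₁,e₂,e₃,e₄ (indexed by 0,1,2,3). -/
def e (i : Fin 4) : V := Pi.single i 1

/-- The neutral metric g with g(e₁,e₁)=g(e₂,e₂)=1, g(e₃,e₃)=g(e₄,e₄)=−1. -/
def gm (x y : V) : ℝ := x 0 * y 0 + x 1 * y 1 - x 2 * y 2 - x 3 * y 3

/-- The signs ε₁=ε₂=1, ε₃=ε₄=−1. -/
def eps : Fin 4 → ℝ := ![1, 1, -1, -1]

/-- J₁ : e₁↦e₂, e₂↦−e₁, e₃↦−e₄, e₄↦e₃. -/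
def J1 (x : V) : V := ![-x 1, x 0, x 3, -x 2]

/-- J₂ : e₁↦e₃, e₂↦e₄, e₃↦−e₁, e₄↦−e₂. -/
def J2 (x : V) : V := ![-x 2, -x 3, x 0, x 1]

/-- J₃ : e₁↦−e₄, e₂↦e₃, e₃↦−e₂, e₄↦e₁. -/
def J3 (x : V) : V := ![x 3, -x 2, x 1, -x 0]

/-- Lie bracket of 𝔤₄,₁ : [e₂,e₄]=e₁, [e₃,e₄]=e₂. -/
def br (x y : V) : V := ![x 1 * y 3 - x 3 * y 1, x 2 * y 3 - x 3 * y 2, 0, 0]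

/-- Fundamental tensor F(x,y,z) = g((∇ₓ J)y, z) for an almost complex structure Jm. -/
def Fa (nab : V →ₗ[ℝ] V →ₗ[ℝ] V) (Jm : V → V) (x y z : V) : ℝ :=
  gm (nab x (Jm y) - Jm (nab x y)) z

/-- Lee form θ(z) = Σᵢ εᵢ F(eᵢ,eᵢ,z). -/
def theta (nab : V →ₗ[ℝ] V →ₗ[ℝ] V) (Jm : V → V) : V → ℝ :=
  fun z => ∑ i, eps i * Fa nab Jm (e i) (e i) z

/-- Curvature operator R(x,y)z = ∇ₓ∇_y z − ∇_y∇ₓ z − ∇_{[x,y]} z. -/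
def Rm (nab : V →ₗ[ℝ] V →ₗ[ℝ] V) (x y z : V) : V :=
  nab x (nab y z) - nab y (nab x z) - nab (br x y) z

/-- Curvature (0,4)-tensor R(x,y,z,w) = g(R(x,y)z, w). -/
def R4 (nab : V →ₗ[ℝ] V →ₗ[ℝ] V) (x y z w : V) : ℝ := gm (Rm nab x y z) w

/-- Ricci tensor ρ(y,z) = Σᵢ εᵢ R(eᵢ,y,z,eᵢ). -/
def ricci (nab : V →ₗ[ℝ] V →ₗ[ℝ] V) (y z : V) : ℝ :=
  ∑ i, eps i * R4 nab (e i) y z (e i)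

/-- Scalar curvature τ = Σⱼ εⱼ ρ(eⱼ,eⱼ). -/
def tau (nab : V →ₗ[ℝ] V →ₗ[ℝ] V) : ℝ := ∑ j, eps j * ricci nab (e j) (e j)

/-- Associated Ricci tensor ρ*(y,z) = Σᵢ εᵢ R(eᵢ,y,z,J eᵢ). -/
def ricciS (nab : V →ₗ[ℝ] V →ₗ[ℝ] V) (Jm : V → V) (y z : V) : ℝ :=
  ∑ i, eps i * R4 nab (e i) y z (Jm (e i))

/-- ∗-scalar curvature τ* = Σⱼ εⱼ ρ*(eⱼ,eⱼ). -/
def tauS (nab : V →ₗ[ℝ] V →ₗ[ℝ] V) (Jm : V → V) : ℝ :=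
  ∑ j, eps j * ricciS nab Jm (e j) (e j)

/-- ∗∗-scalar curvature τ** = Σⱼ εⱼ ρ*(eⱼ,J eⱼ). -/
def tauSS (nab : V →ₗ[ℝ] V →ₗ[ℝ] V) (Jm : V → V) : ℝ :=
  ∑ j, eps j * ricciS nab Jm (e j) (Jm (e j))

/-- Basic sectional curvature k_{ij} = R(eᵢ,eⱼ,eⱼ,eᵢ)/(εᵢεⱼ). -/
def sek (nab : V →ₗ[ℝ] V →ₗ[ℝ] V) (i j : Fin 4) : ℝ :=
  R4 nab (e i) (e j) (e j) (e i) / (eps i * eps j)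

/-- Antisymmetrized Kronecker symbol used to encode curvature-type tensors. -/
def D (a b i j : Fin 4) : ℝ :=
  (if i = a ∧ j = b then (1 : ℝ) else 0) - (if i = b ∧ j = a then (1 : ℝ) else 0)

/-- Closed form of the Levi-Civita connection, read off from the Koszul formula. -/
theorem nab_eq_of_koszul (nab : V →ₗ[ℝ] V →ₗ[ℝ] V)
    (hK : ∀ x y z : V, 2 * gm (nab x y) z = gm (br x y) z + gm (br z x) y + gm (br z y) x)
    (x y : V) :
    nab x y = (1/2 : ℝ) •
      ![x 1 * y 3 - x 3 * y 1,
        x 2 * y 3 - x 3 * y 2 + x 3 * y 0 + x 0 * y 3,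
        -(x 3 * y 1 + x 1 * y 3),
        x 1 * y 0 + x 0 * y 1 + x 2 * y 1 + x 1 * y 2] := by
  have h (k : Fin 4) := hK x y (e k)
  have h0 := h 0
  have h1 := h 1
  have h2 := h 2
  have h3 := h 3
  simp [gm, br, e] at h0 h1 h2 h3
  ext k
  fin_cases k <;> simp <;> linarith

theorem stmt_0
    (nab : V →ₗ[ℝ] V →ₗ[ℝ] V)
    (hK : ∀ x y z : V, 2 * gm (nab x y) z = gm (br x y) z + gm (br z x) y + gm (br z y) x) :
    nab (e 0) (e 1) = (1/2 : ℝ) • e 3 ∧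
    nab (e 1) (e 0) = (1/2 : ℝ) • e 3 ∧
    nab (e 1) (e 2) = (1/2 : ℝ) • e 3 ∧
    nab (e 2) (e 1) = (1/2 : ℝ) • e 3 ∧
    nab (e 0) (e 3) = (1/2 : ℝ) • e 1 ∧
    nab (e 2) (e 3) = (1/2 : ℝ) • e 1 ∧
    nab (e 3) (e 0) = (1/2 : ℝ) • e 1 ∧
    nab (e 3) (e 2) = -((1/2 : ℝ) • e 1) ∧
    nab (e 1) (e 3) = (1/2 : ℝ) • (e 0 - e 2) ∧
    nab (e 3) (e 1) = -((1/2 : ℝ) • (e 0 + e 2)) ∧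
    nab (e 0) (e 0) = 0 ∧ nab (e 0) (e 2) = 0 ∧ nab (e 1) (e 1) = 0 ∧
    nab (e 2) (e 0) = 0 ∧ nab (e 2) (e 2) = 0 ∧ nab (e 3) (e 3) = 0
  := by
    simp only [nab_eq_of_koszul nab hK]
    refine ⟨?_, ?_, ?_, ?_, ?_, ?_, ?_, ?_, ?_, ?_, ?_, ?_, ?_, ?_, ?_, ?_⟩ <;>
      ext k <;> fin_cases k <;> simp [e]
end
end

section
/- For the Lie algebra 𝔤₄,₁, the almost Hermitian structure (J₁,g) belongs to the class W₂ ⊕ W₄ but to neither basic subclass: there exist x,y,z ∈ V with F₁(x,y,z) + F₁(y,z,x) + F₁(z,x,y) ≠ 0 (so the W₂ condition fails), and there exist x,y,z ∈ V with F₁(x,y,z) ≠ ½{ g(x,y)θ₁(z) − g(x,J₁y)θ₁(J₁z) − g(x,z)θ₁(y) + g(x,J₁z)θ₁(J₁y) } (so the W₄ condition fails). -/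
noncomputable section

/-- The fundamental tensor of `J1` is determined by the Koszul formula, since `J1` is
skew-adjoint for `gm`. -/
theorem two_mul_Fa_J1 (nab : V →ₗ[ℝ] V →ₗ[ℝ] V)
    (hK : ∀ x y z : V, 2 * gm (nab x y) z = gm (br x y) z + gm (br z x) y + gm (br z y) x)
    (x y z : V) :
    2 * Fa nab J1 x y z =
      (gm (br x (J1 y)) z + gm (br z x) (J1 y) + gm (br z (J1 y)) x) +
      (gm (br x y) (J1 z) + gm (br (J1 z) x) y + gm (br (J1 z) y) x) := by
  rw [← hK, ← hK]
  simp [Fa, gm, J1]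
  ring

theorem stmt_2
    (nab : V →ₗ[ℝ] V →ₗ[ℝ] V)
    (hK : ∀ x y z : V, 2 * gm (nab x y) z = gm (br x y) z + gm (br z x) y + gm (br z y) x) :
    (∃ x y z : V, Fa nab J1 x y z + Fa nab J1 y z x + Fa nab J1 z x y ≠ 0) ∧
    (∃ x y z : V, Fa nab J1 x y z ≠
      (1/2) * (gm x y * theta nab J1 z - gm x (J1 y) * theta nab J1 (J1 z)
        - gm x z * theta nab J1 y + gm x (J1 z) * theta nab J1 (J1 y)))
  := by
    have hF : ∀ x y z : V, Fa nab J1 x y z = _ := fun x y z =>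
      eq_div_of_mul_eq two_ne_zero ((mul_comm _ _).trans (two_mul_Fa_J1 nab hK x y z))
    refine ⟨⟨e 0, e 2, e 3, ?_⟩, ⟨e 0, e 0, e 3, ?_⟩⟩
    · simp [hF, gm, br, J1, e]
    · simp [theta, Fin.sum_univ_four, hF, gm, br, J1, e, eps]
      norm_num
end
end

section
/- For the Lie algebra 𝔤₄,₁, the basic sectional curvatures are k₁₂ = k₁₄ = −¼, k₁₃ = 0, k₂₃ = ¼, k₂₄ = 1, k₃₄ = −¾. -/
noncomputable section

/-- The Koszul formula determines the connection in coordinates. -/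
theorem nab_eq (nab : V →ₗ[ℝ] V →ₗ[ℝ] V)
    (hK : ∀ x y z : V, 2 * gm (nab x y) z = gm (br x y) z + gm (br z x) y + gm (br z y) x)
    (x y : V) :
    nab x y = ![(x 1 * y 3 - x 3 * y 1) / 2,
      (x 2 * y 3 - x 3 * y 2 + x 3 * y 0 + x 0 * y 3) / 2,
      -(x 3 * y 1 + x 1 * y 3) / 2,
      (x 1 * y 0 + x 0 * y 1 + x 2 * y 1 + x 1 * y 2) / 2] := by
  have h0 := hK x y (e 0)
  have h1 := hK x y (e 1)
  have h2 := hK x y (e 2)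
  have h3 := hK x y (e 3)
  simp [gm, br, e] at h0 h1 h2 h3
  ext i
  fin_cases i <;> simp <;> linarith

theorem stmt_5
    (nab : V →ₗ[ℝ] V →ₗ[ℝ] V)
    (hK : ∀ x y z : V, 2 * gm (nab x y) z = gm (br x y) z + gm (br z x) y + gm (br z y) x) :
    sek nab 0 1 = -(1/4) ∧ sek nab 0 3 = -(1/4) ∧ sek nab 0 2 = 0 ∧
    sek nab 1 2 = 1/4 ∧ sek nab 1 3 = 1 ∧ sek nab 2 3 = -(3/4)
  := by
    refine ⟨?_, ?_, ?_, ?_, ?_, ?_⟩ <;>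
      simp [sek, R4, Rm, nab_eq nab hK, gm, br, e, eps] <;> norm_num
end
end
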